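/- Under the (P4+kP3)-free setup, if there exist two regular cliques at distance at most three from one another, then G has a minimum total dominating set that contains a P3. -/

import Mathlib

open SimpleGraph

namespace TD

variable {V : Type*} {α β : Type*}

/-- `D` is a total dominating set of `G`: every vertex has a neighbor in `D`. -/
def IsTotalDomSet (G : SimpleGraph V) (D : Set V) : Prop :=
  ∀ v : V, ∃ u ∈ D, G.Adj v u

/-- The total domination number `γ_t(G)`. -/
noncomputable def totalDomNum (G : SimpleGraph V) : ℕ :=
  sInf {m : ℕ | ∃ D : Set V, IsTotalDomSet G D ∧ D.ncard = m}

/-- A minimum total dominating set. -/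
def IsMinTotalDomSet (G : SimpleGraph V) (D : Set V) : Prop :=
  IsTotalDomSet G D ∧ D.ncard = totalDomNum G

/-- `S` contains a `P3`: three distinct vertices `a, b, c ∈ S` with `ab, bc ∈ E(G)`. -/
def HasP3 (G : SimpleGraph V) (S : Set V) : Prop :=
  ∃ a b c : V, a ∈ S ∧ b ∈ S ∧ c ∈ S ∧ a ≠ b ∧ b ≠ c ∧ a ≠ c ∧ G.Adj a b ∧ G.Adj b c

/-- `D` is a dominating set of `G`. -/
def IsDomSet (G : SimpleGraph V) (D : Set V) : Prop :=
  ∀ v ∉ D, ∃ u ∈ D, G.Adj v u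

/-- The domination number `γ(G)`. -/
noncomputable def domNum (G : SimpleGraph V) : ℕ :=
  sInf {m : ℕ | ∃ D : Set V, IsDomSet G D ∧ D.ncard = m}

/-- The (open) neighborhood of a set `S`: union of the neighborhoods of its members. -/
def nbhd (G : SimpleGraph V) (S : Set V) : Set V :=
  {v | ∃ u ∈ S, G.Adj u v}

/-- The closed neighborhood `N[S]`. -/
def closedNbhd (G : SimpleGraph V) (S : Set V) : Set V :=
  S ∪ nbhd G S

/-- Distance between two sets of vertices. -/
noncomputable def setDist (G : SimpleGraph V) (S T : Set V) : ℕ :=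
  sInf {m : ℕ | ∃ u ∈ S, ∃ v ∈ T, G.dist u v = m}

/-- `k` disjoint copies of `H`. -/
def kCopies (k : ℕ) (H : SimpleGraph α) : SimpleGraph (Fin k × α) where
  Adj p q := p.1 = q.1 ∧ H.Adj p.2 q.2
  symm := ⟨fun _ _ h => ⟨h.1.symm, h.2.symm⟩⟩
  loopless := ⟨fun p h => H.loopless.irrefl p.2 h.2⟩

/-- The graph `P4 + k·P3`. -/
def p4kp3 (k : ℕ) : SimpleGraph (Fin 4 ⊕ (Fin k × Fin 3)) :=
  (pathGraph 4) ⊕g (kCopies k (pathGraph 3))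

/-- `G` contains no induced copy of `H` (`G` is `H`-free). -/
def IndFree (G : SimpleGraph V) (H : SimpleGraph α) : Prop :=
  ¬ Nonempty (H ↪g G)

/-- `K` is a maximal clique of the subgraph of `G` induced by `C`. -/
def IsMaxCliqueWithin (G : SimpleGraph V) (C K : Set V) : Prop :=
  K ⊆ C ∧ G.IsClique K ∧ ∀ K' : Set V, K' ⊆ C → G.IsClique K' → K ⊆ K' → K' = K

/-- Member of `𝒦'`: a maximal clique of `G[C]` whose closed neighborhood contains no
induced `P4` and such that no vertex of `B` is adjacent to all of its vertices. -/
def GoodClique (G : SimpleGraph V) (B C K : Set V) : Prop :=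
  IsMaxCliqueWithin G C K ∧
    IndFree (G.induce (closedNbhd G K)) (pathGraph 4) ∧
    ¬ ∃ b ∈ B, ∀ x ∈ K, G.Adj b x

/-- A regular clique: a member of `𝒦'` for which there are `k` other members of `𝒦'`
pairwise at distance at least four from one another and from it. -/
def RegularClique (G : SimpleGraph V) (k : ℕ) (B C K : Set V) : Prop :=
  GoodClique G B C K ∧
    ∃ Ks : Fin k → Set V,
      (∀ i, GoodClique G B C (Ks i)) ∧
      (∀ i, 4 ≤ setDist G K (Ks i)) ∧
      ∀ i j : Fin k, i ≠ j → 4 ≤ setDist G (Ks i) (Ks j)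

/-- `w` is a private neighbor of `v` with respect to `D`: `N(w) ∩ D = {v}`. -/
def IsPrivateNbr (G : SimpleGraph V) (D : Set V) (v w : V) : Prop :=
  {u | u ∈ D ∧ G.Adj w u} = {v}

end TD

namespace TD

/-- The vertices outside `K` with a neighbor in `K`. -/
def outer {V : Type*} (G : SimpleGraph V) (K : Set V) : Set V :=
  {v | v ∉ K ∧ ∃ x ∈ K, G.Adj x v}

/-- A nonempty clique `K` with at least one outer neighbor, such that no outside vertex is complete
to `K` and the closed neighborhood of `K` contains no induced `P4`. -/
structure UndominatedClique {V : Type*} (G : SimpleGraph V) (K : Set V) : Prop where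
  clique : G.IsClique K
  nonempty : K.Nonempty
  outer_nonempty : (outer G K).Nonempty
  exists_not_adj : ∀ b ∉ K, ∃ x ∈ K, ¬ G.Adj b x
  p4_free : ∀ a ∈ K ∪ outer G K, ∀ b ∈ K ∪ outer G K, ∀ c ∈ K ∪ outer G K,
    ∀ d ∈ K ∪ outer G K, G.Adj a b → G.Adj b c → G.Adj c d →
      G.Adj a c ∨ G.Adj a d ∨ G.Adj b d

section

variable {V : Type*} {G : SimpleGraph V}

/-- Four vertices inducing a path give an embedding of `P4`. -/
def pathFourEmbedding (a b c d : V) (hab : G.Adj a b) (hbc : G.Adj b c) (hcd : G.Adj c d)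
    (hac : ¬ G.Adj a c) (had : ¬ G.Adj a d) (hbd : ¬ G.Adj b d) : pathGraph 4 ↪g G where
  toFun := ![a, b, c, d]
  inj' := by
    have h1 : a ≠ b := hab.ne
    have h2 : b ≠ c := hbc.ne
    have h3 : c ≠ d := hcd.ne
    have h4 : a ≠ c := by rintro rfl; exact had hcd
    have h5 : b ≠ d := by rintro rfl; exact had hab
    have h6 : a ≠ d := by rintro rfl; exact hac hcd.symm
    intro i j h
    fin_cases i <;> fin_cases j <;> simp_all [eq_comm]
  map_rel_iff' := by
    intro i j
    have hab' := hab.symm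
    have hbc' := hbc.symm
    have hcd' := hcd.symm
    rw [G.adj_comm] at hac had hbd
    have hac' := hac
    have had' := had
    have hbd' := hbd
    rw [G.adj_comm] at hac' had' hbd'
    change G.Adj (![a, b, c, d] i) (![a, b, c, d] j) ↔ _
    fin_cases i <;> fin_cases j <;> simp_all [pathGraph_adj]

/-- Three vertices inducing a path give an embedding of `P3`. -/
def pathThreeEmbedding (a b c : V) (hab : G.Adj a b) (hbc : G.Adj b c) (hne : a ≠ c)
    (hac : ¬ G.Adj a c) : pathGraph 3 ↪g G where
  toFun := ![a, b, c]
  inj' := by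
    have h1 : a ≠ b := hab.ne
    have h2 : b ≠ c := hbc.ne
    intro i j h
    fin_cases i <;> fin_cases j <;> simp_all [eq_comm]
  map_rel_iff' := by
    intro i j
    have hab' := hab.symm
    have hbc' := hbc.symm
    have hac' := hac
    rw [G.adj_comm] at hac'
    change G.Adj (![a, b, c] i) (![a, b, c] j) ↔ _
    fin_cases i <;> fin_cases j <;> simp_all [pathGraph_adj]

/-- Pairwise anticomplete induced paths assemble to an induced `P4 + kP3`. -/
theorem nonempty_p4kp3_embedding {k : ℕ} (p : pathGraph 4 ↪g G) (q : Fin k → (pathGraph 3 ↪g G))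
    (hpq : ∀ a i t, p a ≠ q i t ∧ ¬ G.Adj (p a) (q i t))
    (hqq : ∀ i j, i ≠ j → ∀ s t, q i s ≠ q j t ∧ ¬ G.Adj (q i s) (q j t)) :
    Nonempty (p4kp3 k ↪g G) := by
  refine ⟨⟨⟨Sum.elim p fun x => q x.1 x.2, ?_⟩, ?_⟩⟩
  · rintro (a | ⟨i, s⟩) (b | ⟨j, t⟩) h
    · exact congrArg _ (p.injective h)
    · exact absurd h (hpq a j t).1
    · exact absurd h.symm (hpq b i s).1
    · obtain rfl | hij := eq_or_ne i j
      · exact congrArg (fun t => Sum.inr (i, t)) ((q i).injective h)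
      · exact absurd h (hqq i j hij s t).1
  · rintro (a | ⟨i, s⟩) (b | ⟨j, t⟩)
    · exact p.map_rel_iff'
    · exact iff_of_false (hpq a j t).2 (by simp [p4kp3])
    · exact iff_of_false (fun h => (hpq b i s).2 h.symm) (by simp [p4kp3])
    · obtain rfl | hij := eq_or_ne i j
      · exact (q i).map_adj_iff.trans (and_iff_right rfl).symm
      · exact iff_of_false (hqq i j hij s t).2 (by simp [p4kp3, kCopies, hij])

/-- If `A` induces `P4 + mP3` in a `(P4 + (m+1)P3)`-free graph, the vertices anticomplete to `A`
induce no `P3`. -/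
theorem adj_of_anticomplete {m : ℕ} (hfree : IndFree G (p4kp3 (m + 1))) {A C : Set V}
    (e : G.induce A ≃g p4kp3 m) (hAC : ∀ x ∈ A, ∀ y ∈ C, x ≠ y ∧ ¬ G.Adj x y)
    {a b c : V} (ha : a ∈ C) (hb : b ∈ C) (hc : c ∈ C) (hab : G.Adj a b) (hbc : G.Adj b c)
    (hne : a ≠ c) : G.Adj a c := by
  by_contra hac
  let f : p4kp3 m ↪g G := e.symm.toEmbedding.trans (Embedding.induce A)
  have hf : ∀ x, f x ∈ A := fun x => (e.symm x).2
  let r : pathGraph 3 ↪g G := pathThreeEmbedding a b c hab hbc hne hac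
  have hr : ∀ t, r t ∈ C := by
    intro t
    fin_cases t
    exacts [ha, hb, hc]
  let p : pathGraph 4 ↪g p4kp3 m := Embedding.sumInl
  let q : Fin m → (pathGraph 3 ↪g p4kp3 m) := fun i =>
    ⟨⟨fun t => Sum.inr (i, t), fun s t h => by simpa using h⟩, by
      intro s t
      exact and_iff_right rfl⟩
  refine hfree (nonempty_p4kp3_embedding (p.trans f)
    (Fin.snoc (α := fun _ => pathGraph 3 ↪g G) (fun i => (q i).trans f) r) ?_ ?_)
  · intro x i t
    induction i using Fin.lastCases with
    | last => simpa using hAC _ (hf _) _ (hr t)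
    | cast i =>
      simp only [Fin.snoc_castSucc]
      refine ⟨fun h => ?_, fun h => ?_⟩
      · have := f.injective h
        simp [p, q] at this
      · have := f.map_adj_iff.1 h
        simp [p, q, p4kp3] at this
  · intro i j hij s t
    induction i using Fin.lastCases with
    | last =>
      induction j using Fin.lastCases with
      | last => exact absurd rfl hij
      | cast j =>
        have := hAC _ (hf (q j t)) _ (hr s)
        simpa [G.adj_comm, eq_comm] using this
    | cast i =>
      induction j using Fin.lastCases with
      | last => simpa using hAC _ (hf (q i s)) _ (hr t)
      | cast j =>
        simp only [Fin.snoc_castSucc]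
        have hij' : i ≠ j := fun h => hij (by rw [h])
        refine ⟨fun h => ?_, fun h => ?_⟩
        · exact hij' (congrArg Prod.fst (Sum.inr_injective (f.injective h)))
        · have : (p4kp3 m).Adj (.inr (i, s)) (.inr (j, t)) := f.map_adj_iff.1 h
          exact hij' this.1

/-- Closed neighborhoods of sets at distance at least four are disjoint and anticomplete. -/
theorem anticomplete_of_setDist (hconn : G.Connected) {K L : Set V} (h : 4 ≤ setDist G K L)
    {p q : V} (hp : p ∈ K ∪ outer G K) (hq : q ∈ L ∪ outer G L) : p ≠ q ∧ ¬ G.Adj p q := by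
  have near : ∀ {M : Set V} {p : V}, p ∈ M ∪ outer G M → ∃ x ∈ M, G.dist x p ≤ 1 := by
    rintro M p (hp | ⟨-, x, hx, hxp⟩)
    · exact ⟨p, hp, by simp⟩
    · exact ⟨x, hx, (dist_eq_one_iff_adj.2 hxp).le⟩
  obtain ⟨x, hx, hxp⟩ := near hp
  obtain ⟨y, hy, hyq⟩ := near hq
  have hxy : 4 ≤ G.dist x y := h.trans (Nat.sInf_le ⟨x, hx, y, hy, rfl⟩)
  have h1 := hconn.dist_triangle (u := x) (v := p) (w := y)
  have h2 := hconn.dist_triangle (u := p) (v := q) (w := y)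
  rw [dist_comm] at hyq
  refine ⟨?_, fun hpq => ?_⟩
  · rintro rfl
    omega
  · rw [dist_eq_one_iff_adj.2 hpq] at h2
    omega

/-- Every outer neighbor `b` of `K` forms, with some vertex of `K`, a pair totally dominating the
closed neighborhood of `K`. -/
theorem UndominatedClique.exists_pair [Finite V] {K : Set V} (hK : UndominatedClique G K) {b : V}
    (hb : b ∈ outer G K) :
    ∃ u ∈ K, G.Adj b u ∧ ∀ v ∈ K ∪ outer G K, G.Adj v u ∨ G.Adj v b := by
  let S : Set V := {c | c ∈ outer G K ∧ ¬ G.Adj c b}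
  let N : V → Set V := fun c => {x | x ∈ K ∧ G.Adj c x}
  have nested : ∀ c ∈ outer G K, ∀ d ∈ outer G K, ¬ G.Adj c d → N c ⊆ N d ∨ N d ⊆ N c := by
    intro c hc d hd hcd
    by_contra! h
    obtain ⟨x, hxc, hxd⟩ := Set.not_subset.1 h.1
    obtain ⟨y, hyd, hyc⟩ := Set.not_subset.1 h.2
    have hcy : ¬ G.Adj c y := fun h => hyc ⟨hyd.1, h⟩
    have hxd' : ¬ G.Adj x d := fun h => hxd ⟨hxc.1, h.symm⟩
    have hxy : G.Adj x y := hK.clique hxc.1 hyd.1 (by rintro rfl; exact hcy hxc.2)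
    rcases hK.p4_free c (.inr hc) x (.inl hxc.1) y (.inl hyd.1) d (.inr hd) hxc.2 hxy
      hyd.2.symm with h | h | h
    exacts [hcy h, hcd h, hxd' h]
  have adjacent : ∀ c ∈ outer G K, ∀ d ∈ outer G K, G.Adj c d → ∀ y ∈ K, ¬ G.Adj c y →
      ¬ G.Adj d y → N c ⊆ N d := by
    intro c hc d hd hcd y hy hcy hdy x hx
    by_contra hxd
    have hdx : ¬ G.Adj d x := fun h => hxd ⟨hx.1, h⟩
    have hxy : G.Adj x y := hK.clique hx.1 hy (by rintro rfl; exact hcy hx.2)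
    rcases hK.p4_free d (.inr hd) c (.inr hc) x (.inl hx.1) y (.inl hy) hcd.symm hx.2 hxy
      with h | h | h
    exacts [hdx h, hdy h, hcy h]
  obtain ⟨c, hcS, hcmin⟩ := Set.exists_min_image S (fun c => (N c).ncard) (Set.toFinite S)
    ⟨b, hb, G.loopless.irrefl b⟩
  have sub : ∀ d ∈ S, N c ⊆ N d := by
    intro d hd
    have chain : N c ⊆ N d ∨ N d ⊆ N c := by
      by_cases hcd : G.Adj c d
      · obtain ⟨y, hy, hby⟩ := hK.exists_not_adj b hb.1
        rcases nested c hcS.1 b hb hcS.2 with h1 | h1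
        · rcases nested d hd.1 b hb hd.2 with h2 | h2
          · exact .inl (adjacent c hcS.1 d hd.1 hcd y hy (fun h => hby (h1 ⟨hy, h⟩).2)
              fun h => hby (h2 ⟨hy, h⟩).2)
          · exact .inl (h1.trans h2)
        · rcases nested d hd.1 b hb hd.2 with h2 | h2
          · exact .inr (h2.trans h1)
          · have hbS : b ∈ S := ⟨hb, G.loopless.irrefl b⟩
            have := Set.eq_of_subset_of_ncard_le h1 (hcmin b hbS) (Set.toFinite _)
            exact .inl (this ▸ h2)
      · exact nested c hcS.1 d hd.1 hcd
    rcases chain with h | h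
    · exact h
    · exact (Set.eq_of_subset_of_ncard_le h (hcmin d hd) (Set.toFinite _)).ge
  obtain ⟨u, hu, huc⟩ := hcS.1.2
  have hall : ∀ d ∈ S, G.Adj d u := fun d hd => (sub d hd ⟨hu, huc.symm⟩).2
  have hbu : G.Adj b u := hall b ⟨hb, G.loopless.irrefl b⟩
  refine ⟨u, hu, hbu, ?_⟩
  rintro v (hv | hv)
  · obtain rfl | hvu := eq_or_ne v u
    · exact .inr hbu.symm
    · exact .inl (hK.clique hv hu hvu)
  · by_cases hvb : G.Adj v b
    · exact .inr hvb
    · exact .inl (hall v ⟨hv, hvb⟩)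

theorem ncard_pair_le (u b : V) : ({u, b} : Set V).ncard ≤ 2 := by
  simpa using Set.ncard_insert_le u {b}

theorem mem_closed_of_adj {K : Set V} {x v : V} (hx : x ∈ K) (h : G.Adj x v) :
    v ∈ K ∪ outer G K := by
  by_cases hv : v ∈ K
  · exact .inl hv
  · exact .inr ⟨hv, x, hx, h⟩

theorem IsMinTotalDomSet.le_ncard {D E : Set V} (hD : IsMinTotalDomSet G D)
    (hE : IsTotalDomSet G E) : D.ncard ≤ E.ncard :=
  hD.2.trans_le (Nat.sInf_le ⟨E, hE, rfl⟩)

/-- Exchanging part of a minimum total dominating set. -/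
theorem IsMinTotalDomSet.exchange [Finite V] {D X Y : Set V} (hD : IsMinTotalDomSet G D)
    (hcard : Y.ncard ≤ (D ∩ X).ncard)
    (hdom : ∀ v, (∃ u ∈ D, u ∉ X ∧ G.Adj v u) ∨ ∃ u ∈ Y, G.Adj v u) :
    IsMinTotalDomSet G (D \ X ∪ Y) := by
  have hT : IsTotalDomSet G (D \ X ∪ Y) := by
    intro v
    rcases hdom v with ⟨u, hu, huX, h⟩ | ⟨u, hu, h⟩
    · exact ⟨u, .inl ⟨hu, huX⟩, h⟩
    · exact ⟨u, .inr hu, h⟩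
  refine ⟨hT, le_antisymm ?_ (Nat.sInf_le ⟨_, hT, rfl⟩)⟩
  rw [← hD.2, ← Set.ncard_inter_add_ncard_sdiff_eq_ncard D X]
  have := Set.ncard_union_le (D \ X) Y
  omega

/-- If a totally dominating set has two vertices in `K`, all of `D ∩ K` can be exchanged for a pair
totally dominating the closed neighborhood of `K`. -/
theorem IsMinTotalDomSet.exchange_clique [Finite V] {D K : Set V} (hD : IsMinTotalDomSet G D)
    (hcard : 2 ≤ (D ∩ K).ncard) {u b : V}
    (hub : ∀ v ∈ K ∪ outer G K, G.Adj v u ∨ G.Adj v b) :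
    IsMinTotalDomSet G (D \ K ∪ {u, b}) := by
  refine hD.exchange ((ncard_pair_le u b).trans hcard) fun v => ?_
  obtain ⟨w, hw, hvw⟩ := hD.1 v
  by_cases hwK : w ∈ K
  · rcases hub v (mem_closed_of_adj hwK hvw.symm) with h | h
    · exact .inr ⟨u, by simp, h⟩
    · exact .inr ⟨b, by simp, h⟩
  · exact .inl ⟨w, hw, hwK, hvw⟩

theorem UndominatedClique.two_le_ncard [Finite V] {K : Set V} (hK : UndominatedClique G K)
    {D : Set V} (hD : IsTotalDomSet G D) : 2 ≤ (D ∩ (K ∪ outer G K)).ncard := by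
  have main : ∃ x ∈ D ∩ (K ∪ outer G K), ∃ y ∈ D ∩ (K ∪ outer G K), x ≠ y := by
    obtain ⟨x, hx⟩ := hK.nonempty
    obtain ⟨d, hd, hxd⟩ := hD x
    by_cases hdK : d ∈ K
    · obtain ⟨e, he, hde⟩ := hD d
      exact ⟨d, ⟨hd, .inl hdK⟩, e, ⟨he, mem_closed_of_adj hdK hde⟩, hde.ne⟩
    · obtain ⟨y, hy, hdy⟩ := hK.exists_not_adj d hdK
      obtain ⟨e, he, hye⟩ := hD y
      refine ⟨d, ⟨hd, mem_closed_of_adj hx hxd⟩, e, ⟨he, mem_closed_of_adj hy hye⟩, ?_⟩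
      rintro rfl
      exact hdy hye.symm
  obtain ⟨x, hx, y, hy, hxy⟩ := main
  exact (Set.one_lt_ncard (Set.toFinite _)).2 ⟨x, hx, y, hy, hxy⟩

/-- A minimum total dominating set containing a vertex complete to the outer neighborhood of `K`
can be turned into one containing a `P3`. -/
theorem UndominatedClique.exists_hasP3 [Finite V] {K : Set V} (hK : UndominatedClique G K)
    {D : Set V} (hD : IsMinTotalDomSet G D) {z : V} (hzD : z ∈ D) (hzK : z ∉ K)
    (hz : ∀ c ∈ outer G K, G.Adj z c) : ∃ D', IsMinTotalDomSet G D' ∧ HasP3 G D' := by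
  by_cases h1 : 2 ≤ (D ∩ K).ncard
  · obtain ⟨b, hb⟩ := hK.outer_nonempty
    obtain ⟨u, hu, hbu, hub⟩ := hK.exists_pair hb
    refine ⟨_, hD.exchange_clique h1 hub, z, b, u, .inl ⟨hzD, hzK⟩, .inr (by simp),
      .inr (by simp), (hz b hb).ne, hbu.ne, ?_, hz b hb, hbu⟩
    rintro rfl
    exact hzK hu
  by_cases h2 : 2 ≤ (D ∩ outer G K).ncard
  · obtain ⟨b, hb, c, hc, hbc⟩ := (Set.one_lt_ncard (Set.toFinite _)).1 h2
    exact ⟨D, hD, b, z, c, hb.1, hzD, hc.1, (hz b hb.2).ne', (hz c hc.2).ne, hbc,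
      (hz b hb.2).symm, hz c hc.2⟩
  have h3 := hK.two_le_ncard hD.1
  rw [Set.inter_union_distrib_left] at h3
  have h4 := Set.ncard_union_le (D ∩ K) (D ∩ outer G K)
  obtain ⟨u, hu⟩ := Set.ncard_pos (Set.toFinite _) |>.1 (show 0 < (D ∩ K).ncard by omega)
  obtain ⟨b, hb, hub⟩ := hD.1 u
  have hbK : b ∉ K := fun hbK =>
    h1 ((Set.one_lt_ncard (Set.toFinite _)).2 ⟨u, hu, b, ⟨hb, hbK⟩, hub.ne⟩)
  have hbo : b ∈ outer G K := ⟨hbK, u, hu.2, hub⟩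
  refine ⟨D, hD, z, b, u, hzD, hb, hu.1, (hz b hbo).ne, hub.ne', ?_, hz b hbo, hub.symm⟩
  rintro rfl
  exact hzK hu.2

/-- In a `(P4 + kP3)`-free graph, given cliques `L i` far from `K` and from one another, a vertex
at distance two from `K` is complete to the outer neighborhood of one of them. -/
theorem UndominatedClique.exists_complete_outer {k : ℕ} (hconn : G.Connected)
    (hfree : IndFree G (p4kp3 k)) {K : Set V} (hK : UndominatedClique G K) {L : Fin k → Set V}
    (hL : ∀ i, UndominatedClique G (L i)) (hKL : ∀ i, 4 ≤ setDist G K (L i))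
    (hLL : ∀ i j, i ≠ j → 4 ≤ setDist G (L i) (L j)) {b z : V} (hb : b ∈ outer G K)
    (hbz : G.Adj b z) (hz : z ∉ K ∪ outer G K) :
    ∃ i, z ∉ L i ∪ outer G (L i) ∧ ∀ c ∈ outer G (L i), G.Adj z c := by
  have hzL : ∀ i, z ∉ L i ∪ outer G (L i) := fun i h =>
    (anticomplete_of_setDist hconn (hKL i) (.inr hb) h).2 hbz
  by_contra! h
  choose c hc hzc using fun i => h i (hzL i)
  obtain ⟨x, hx, hxb⟩ := hb.2
  obtain ⟨y, hy, hby⟩ := hK.exists_not_adj b hb.1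
  have hyx : G.Adj y x := hK.clique hy hx (by rintro rfl; exact hby hxb.symm)
  have hzx : ∀ w ∈ K, ¬ G.Adj w z := fun w hw h => hz (mem_closed_of_adj hw h)
  choose s hs hsc using fun i => (hc i).2
  choose t ht hct using fun i => (hL i).exists_not_adj (c i) (hc i).1
  have hst : ∀ i, G.Adj (s i) (t i) := fun i =>
    (hL i).clique (hs i) (ht i) fun h => hct i (h ▸ (hsc i).symm)
  let p := pathFourEmbedding y x b z hyx hxb hbz (fun h => hby h.symm) (hzx y hy) (hzx x hx)
  let q : ∀ i, pathGraph 3 ↪g G := fun i =>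
    pathThreeEmbedding (c i) (s i) (t i) (hsc i).symm (hst i)
      (fun h => (hc i).1 (h ▸ ht i)) (hct i)
  have hq : ∀ i r, q i r ∈ L i ∪ outer G (L i) := by
    intro i r
    fin_cases r
    exacts [.inr (hc i), .inl (hs i), .inl (ht i)]
  have hzq : ∀ i r, ¬ G.Adj z (q i r) := by
    intro i r
    fin_cases r
    exacts [hzc i, fun h => hzL i (mem_closed_of_adj (hs i) h.symm),
      fun h => hzL i (mem_closed_of_adj (ht i) h.symm)]
  refine hfree (nonempty_p4kp3_embedding p q ?_ fun i j hij r r' =>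
    anticomplete_of_setDist hconn (hLL i j hij) (hq i r) (hq j r'))
  intro a i r
  fin_cases a
  · exact anticomplete_of_setDist hconn (hKL i) (.inl hy) (hq i r)
  · exact anticomplete_of_setDist hconn (hKL i) (.inl hx) (hq i r)
  · exact anticomplete_of_setDist hconn (hKL i) (.inr hb) (hq i r)
  · refine ⟨fun h => hzL i ?_, hzq i r⟩
    have : z = q i r := h
    exact this ▸ hq i r

/-- Let the cliques `L i` be far from `K` and from one another. If `D` meets every `outer G (L i)`,
then `D` can be changed within the closed neighborhood of `K` to contain any pair totally dominating
that neighborhood. -/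
theorem UndominatedClique.exchange_closed [Finite V] {k : ℕ} (hconn : G.Connected)
    (hfree : IndFree G (p4kp3 k)) {K : Set V} (hK : UndominatedClique G K) {L : Fin k → Set V}
    (hL : ∀ i, UndominatedClique G (L i)) (hKL : ∀ i, 4 ≤ setDist G K (L i))
    (hLL : ∀ i j, i ≠ j → 4 ≤ setDist G (L i) (L j)) {D : Set V} (hD : IsMinTotalDomSet G D)
    (hDL : ∀ i, (D ∩ outer G (L i)).Nonempty) {u b : V}
    (hub : ∀ v ∈ K ∪ outer G K, G.Adj v u ∨ G.Adj v b) :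
    IsMinTotalDomSet G (D \ (K ∪ outer G K) ∪ {u, b}) := by
  refine hD.exchange ((ncard_pair_le u b).trans (hK.two_le_ncard hD.1)) fun v => ?_
  by_cases hv : v ∈ K ∪ outer G K
  · rcases hub v hv with h | h
    · exact .inr ⟨u, by simp, h⟩
    · exact .inr ⟨b, by simp, h⟩
  left
  obtain ⟨w, hw, hvw⟩ := hD.1 v
  by_cases hwK : w ∈ K ∪ outer G K
  · have hwo : w ∈ outer G K := hwK.resolve_left fun h => hv (mem_closed_of_adj h hvw.symm)
    obtain ⟨i, -, hi⟩ := hK.exists_complete_outer hconn hfree hL hKL hLL hwo hvw.symm hv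
    obtain ⟨c, hcD, hc⟩ := hDL i
    exact ⟨c, hcD, fun h => (anticomplete_of_setDist hconn (hKL i) h (.inr hc)).1 rfl, hi c hc⟩
  · exact ⟨w, hw, hwK, hvw⟩

/-- If disjoint anticomplete cliques are at distance at most three, they have a common outer
neighbor or adjacent outer neighbors. -/
theorem exists_connection (hconn : G.Connected) {K L : Set V} (hK : K.Nonempty) (hL : L.Nonempty)
    (hKL : ∀ x ∈ K, ∀ y ∈ L, x ≠ y ∧ ¬ G.Adj x y) (hd : setDist G K L ≤ 3) :
    (∃ b, b ∈ outer G K ∧ b ∈ outer G L) ∨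
      ∃ b ∈ outer G K, ∃ c ∈ outer G L, G.Adj b c := by
  have two : ∀ x ∈ K, ∀ y ∈ L, ∀ w, G.Adj x w → G.Adj w y → w ∈ outer G K ∧ w ∈ outer G L :=
    fun x hx y hy w hxw hwy => ⟨⟨fun h => (hKL w h y hy).2 hwy, x, hx, hxw⟩,
      ⟨fun h => (hKL x hx w h).2 hxw, y, hy, hwy.symm⟩⟩
  have hne : {m : ℕ | ∃ u ∈ K, ∃ v ∈ L, G.dist u v = m}.Nonempty :=
    ⟨_, hK.some, hK.some_mem, hL.some, hL.some_mem, rfl⟩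
  obtain ⟨x, hx, y, hy, hxy⟩ := Nat.sInf_mem hne
  change G.dist x y = setDist G K L at hxy
  obtain ⟨p, hp⟩ := hconn.exists_walk_length_eq_dist x y
  have hlen : p.length ≤ 3 := by omega
  clear hp hxy
  match p, hlen with
  | .nil, _ => exact absurd rfl (hKL x hx _ hy).1
  | .cons h .nil, _ => exact absurd h (hKL x hx _ hy).2
  | .cons h₁ (.cons h₂ .nil), _ => exact .inl ⟨_, two x hx _ hy _ h₁ h₂⟩
  | .cons (v := v) h₁ (.cons (v := w) h₂ (.cons h₃ .nil)), _ =>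
    by_cases hv : v ∈ K
    · exact .inl ⟨w, two v hv _ hy w h₂ h₃⟩
    by_cases hw : w ∈ L
    · exact .inl ⟨v, two x hx w hw v h₁ h₂⟩
    exact .inr ⟨v, ⟨hv, x, hx, h₁⟩, w, ⟨hw, _, hy, h₃.symm⟩, h₂⟩
  | .cons _ (.cons _ (.cons _ (.cons _ p))), h =>
    simp only [Walk.length_cons] at h
    omega

theorem nonempty_of_four_le_setDist {K L : Set V} (h : 4 ≤ setDist G K L) :
    K.Nonempty ∧ L.Nonempty := by
  obtain ⟨-, x, hx, y, hy, -⟩ := Nat.nonempty_of_pos_sInf (lt_of_lt_of_le (by norm_num) h)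
  exact ⟨⟨x, hx⟩, ⟨y, hy⟩⟩

theorem exists_mem_outer (hconn : G.Connected) {K : Set V} {x y : V} (hx : x ∈ K) (hy : y ∉ K) :
    (outer G K).Nonempty := by
  obtain ⟨p⟩ := hconn.preconnected x y
  obtain ⟨d, -, h1, h2⟩ := p.exists_boundary_dart K hx hy
  exact ⟨d.snd, h2, d.fst, h1, d.adj⟩

theorem exists_isMinTotalDomSet (h : ∀ v, ∃ u, G.Adj v u) : ∃ D, IsMinTotalDomSet G D := by
  have hne : {m : ℕ | ∃ D : Set V, IsTotalDomSet G D ∧ D.ncard = m}.Nonempty :=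
    ⟨_, Set.univ, fun v => (h v).imp fun u hu => ⟨trivial, hu⟩, rfl⟩
  exact Nat.sInf_mem hne

end

end TD

open TD SimpleGraph


theorem stmt11 {V : Type*} [Fintype V] (k : ℕ) (hk : 1 ≤ k)
    (G : SimpleGraph V) (hconn : G.Connected) (hfree : IndFree G (p4kp3 k))
    (A B C : Set V) (hA : Nonempty (G.induce A ≃g p4kp3 (k - 1)))
    (hB : B = {v | v ∉ A ∧ ∃ a ∈ A, G.Adj v a})
    (hC : C = {v | v ∉ A ∧ v ∉ B})
    (K K' : Set V) (hK : RegularClique G k B C K) (hK' : RegularClique G k B C K')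
    (hne : K ≠ K') (hd : setDist G K K' ≤ 3) :
    ∃ D, IsMinTotalDomSet G D ∧ HasP3 G D := by

  have hAC : ∀ x ∈ A, ∀ y ∈ C, x ≠ y ∧ ¬ G.Adj x y := by
    subst hB hC
    rintro x hx y ⟨hyA, hyB⟩
    exact ⟨fun h => hyA (h ▸ hx), fun h => hyB ⟨hyA, x, hx, h.symm⟩⟩
  have hBC : ∀ x ∈ B, x ∉ C := by
    subst hC
    exact fun x hx h => h.2 hx
  obtain ⟨m, rfl⟩ : ∃ m, k = m + 1 := ⟨k - 1, by omega⟩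
  obtain ⟨e⟩ := hA
  have hA0 : (e.symm (Sum.inl 0)).1 ∈ A := (e.symm (Sum.inl 0)).2
  have outerB : ∀ L, GoodClique G B C L → outer G L ⊆ B := by
    rintro L hL v ⟨hvL, x, hx, hxv⟩
    have hvA : v ∉ A := fun h => (hAC v h x (hL.1.1 hx)).2 hxv.symm
    by_contra hvB
    have hvC : v ∈ C := by rw [hC]; exact ⟨hvA, hvB⟩
    have hcl : G.IsClique (insert v L) := by
      refine hL.1.2.1.insert fun y hy hvy => ?_
      obtain rfl | hxy := eq_or_ne x y
      · exact hxv.symm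
      · exact adj_of_anticomplete hfree e hAC hvC (hL.1.1 hx) (hL.1.1 hy) hxv.symm
          (hL.1.2.1 hx hy hxy) hvy
    have := hL.1.2.2 _ (Set.insert_subset hvC hL.1.1) hcl (Set.subset_insert v L)
    exact hvL (this ▸ Set.mem_insert v L)
  have und : ∀ L, GoodClique G B C L → L.Nonempty → UndominatedClique G L := by
    intro L hL hne
    have hcn : ∀ v ∈ L ∪ outer G L, v ∈ closedNbhd G L := by
      rintro v (h | h)
      exacts [.inl h, .inr h.2]
    refine ⟨hL.1.2.1, hne, ?_, ?_, ?_⟩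
    · exact exists_mem_outer hconn hne.some_mem fun h => (hAC _ hA0 _ (hL.1.1 h)).1 rfl
    · intro b hb
      by_contra! h
      exact hL.2.2 ⟨b, outerB L hL ⟨hb, hne.some, hne.some_mem, (h _ hne.some_mem).symm⟩, h⟩
    · intro a ha b hb c hc d hd hab hbc hcd
      by_contra! h
      exact hL.2.1 ⟨pathFourEmbedding (G := G.induce (closedNbhd G L)) ⟨a, hcn a ha⟩
        ⟨b, hcn b hb⟩ ⟨c, hcn c hc⟩ ⟨d, hcn d hd⟩ hab hbc hcd h.1 h.2.1 h.2.2⟩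
  obtain ⟨hKg, L, hLg, hKL, hLL⟩ := hK
  obtain ⟨hKg', L', hLg', hKL', hLL'⟩ := hK'
  have hKne := (nonempty_of_four_le_setDist (hKL 0)).1
  have hKne' := (nonempty_of_four_le_setDist (hKL' 0)).1
  have hKu := und K hKg hKne
  have hKu' := und K' hKg' hKne'
  have hLu := fun i => und (L i) (hLg i) (nonempty_of_four_le_setDist (hKL i)).2
  have hLu' := fun i => und (L' i) (hLg' i) (nonempty_of_four_le_setDist (hKL' i)).2
  have hdisj : ∀ x ∈ K, x ∉ K' := by
    intro x hx hx'
    refine hne (hKg'.1.2.2 K hKg.1.1 hKg.1.2.1 fun y hy => ?_)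
    by_contra hyK
    have hxy : G.Adj x y := hKg'.1.2.1 hx' hy (by rintro rfl; exact hyK hx)
    exact hBC y (outerB K hKg ⟨hyK, x, hx, hxy⟩) (hKg'.1.1 hy)
  have hanti : ∀ x ∈ K, ∀ y ∈ K', x ≠ y ∧ ¬ G.Adj x y := fun x hx y hy =>
    ⟨fun h => hdisj x hx (h ▸ hy), fun h =>
      hBC y (outerB K hKg ⟨fun hyK => hdisj y hyK hy, x, hx, h⟩) (hKg'.1.1 hy)⟩
  have hnbr : ∀ v, ∃ u, G.Adj v u := by
    intro v
    have : ∃ y, y ∉ ({v} : Set V) := by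
      obtain ⟨x, hx⟩ := hKne
      obtain ⟨y, hy⟩ := hKne'
      by_contra! h
      exact (hanti x hx y hy).1 ((h x).trans (h y).symm)
    obtain ⟨y, hy⟩ := this
    obtain ⟨u, -, x, rfl, hxu⟩ := exists_mem_outer hconn (Set.mem_singleton v) hy
    exact ⟨u, hxu⟩
  obtain ⟨D, hD, hDmax⟩ := Set.exists_max_image {D | IsMinTotalDomSet G D}
    (fun D => (D ∩ B).ncard) (Set.toFinite _) (exists_isMinTotalDomSet hnbr)
  have hmeet : ∀ i, (D ∩ outer G (L' i)).Nonempty := by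
    intro i
    by_contra hempty
    have h2 := (hLu' i).two_le_ncard hD.1
    rw [Set.inter_union_distrib_left, Set.not_nonempty_iff_eq_empty.1 hempty, Set.union_empty] at h2
    obtain ⟨b, hb⟩ := (hLu' i).outer_nonempty
    obtain ⟨u, -, -, hub⟩ := (hLu' i).exists_pair hb
    refine (hDmax _ (hD.exchange_clique h2 hub)).not_gt (Set.ncard_lt_ncard ?_ (Set.toFinite _))
    have hbB := outerB _ (hLg' i) hb
    refine Set.ssubset_iff_of_subset ?_ |>.2 ⟨b, ⟨.inr (by simp), hbB⟩, fun h => hempty ⟨b, h.1, hb⟩⟩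
    exact fun x hx => ⟨.inl ⟨hx.1, fun h => hBC x hx.2 ((hLg' i).1.1 h)⟩, hx.2⟩
  have finish : ∀ b ∈ outer G K, ∀ z, G.Adj b z → z ∉ K ∪ outer G K → ∀ s t,
      (∀ v ∈ K' ∪ outer G K', G.Adj v s ∨ G.Adj v t) → z ∈ ({s, t} : Set V) →
      ∃ D, IsMinTotalDomSet G D ∧ HasP3 G D := by
    intro b hb z hbz hz s t hst hzst
    obtain ⟨i, hi, hcomp⟩ := hKu.exists_complete_outer hconn hfree hLu hKL hLL hb hbz hz
    exact (hLu i).exists_hasP3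
      (hKu'.exchange_closed hconn hfree hLu' hKL' hLL' hD hmeet hst) (.inr hzst)
      (fun h => hi (.inl h)) hcomp
  have common : ∀ b ∈ outer G K, b ∈ outer G K' → ∃ D, IsMinTotalDomSet G D ∧ HasP3 G D := by
    intro b hb hb'
    obtain ⟨u, hu, hbu, hub⟩ := hKu'.exists_pair hb'
    refine finish b hb u hbu ?_ u b hub (by simp)
    rintro (h | ⟨-, x, hx, hxu⟩)
    exacts [hdisj u h hu, (hanti x hx u hu).2 hxu]
  rcases exists_connection hconn hKne hKne' hanti hd with ⟨b, hb, hb'⟩ | ⟨b, hb, c, hc, hbc⟩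
  · exact common b hb hb'
  by_cases hcK : c ∈ outer G K
  · exact common c hcK hc
  obtain ⟨u, hu, -, hub⟩ := hKu'.exists_pair hc
  refine finish b hb c hbc ?_ u c hub (by simp)
  rintro (h | h)
  · obtain ⟨-, y, hy, hyc⟩ := hc
    exact (hanti c h y hy).2 hyc.symm
  · exact hcK h
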